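/- Let (E₁,…,E_{n−2},X,T) be a complete exceptional sequence over a hereditary algebra and let (E₁,…,E_{n−2},T,Y) be the complete exceptional sequence obtained by braid mutation of the last two terms. If Y is a projective Λ-module P_i, then X is both relatively projective and relatively injective in (E₁,…,E_{n−2},X,T); equivalently, X is a projective object of T^⊥. -/

import Mathlib

open CategoryTheory

universe u

variable {A : Type u} [Ring A]

namespace ExcSeq

/-- `Hom(X, Y) = 0`. -/
def homZero (X Y : ModuleCat.{u} A) : Prop := ∀ f : X ⟶ Y, f = 0

/-- `Ext¹(X, Y) = 0`: every short exact sequence `0 → Y → E → X → 0` splits. -/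
def extZero (X Y : ModuleCat.{u} A) : Prop :=
  ∀ (E : ModuleCat.{u} A) (i : Y ⟶ E) (p : E ⟶ X) (w : i ≫ p = 0),
    (ShortComplex.mk i p w).ShortExact → ∃ s : X ⟶ E, s ≫ p = 𝟙 X

/-- `Y` belongs to the right perpendicular category `X^⊥`. -/
def rperp (X Y : ModuleCat.{u} A) : Prop := homZero X Y ∧ extZero X Y

/-- `Y` belongs to the left perpendicular category `^⊥X`. -/
def lperp (X Y : ModuleCat.{u} A) : Prop := homZero Y X ∧ extZero Y X

/-- An exceptional module: finitely generated, rigid, with division algebra endomorphism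
ring (in particular nonzero and indecomposable). -/
def ExceptionalMod (X : ModuleCat.{u} A) : Prop :=
  Module.Finite A X ∧ extZero X X ∧ Nontrivial X ∧ ∀ f : X ⟶ X, f ≠ 0 → IsIso f

/-- An exceptional sequence `(E 0, …, E (n-1))`. -/
def IsExcSeq {n : ℕ} (E : Fin n → ModuleCat.{u} A) : Prop :=
  (∀ i, ExceptionalMod (E i)) ∧ ∀ i j : Fin n, i < j → rperp (E j) (E i)

/-- A complete exceptional sequence: an exceptional sequence of maximal length. -/
def CompleteES {n : ℕ} (E : Fin n → ModuleCat.{u} A) : Prop :=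
  IsExcSeq E ∧ ∀ (m : ℕ) (F : Fin m → ModuleCat.{u} A), IsExcSeq F → m ≤ n

/-- The wide subcategory `𝒜ₖ = (E_{k+1} ⊕ ⋯ ⊕ Eₙ)^⊥`. -/
def Aperp {n : ℕ} (E : Fin n → ModuleCat.{u} A) (k : Fin n) (X : ModuleCat.{u} A) : Prop :=
  ∀ j : Fin n, k < j → rperp (E j) X

/-- The wide subcategory `ℬₖ = ^⊥(E₁ ⊕ ⋯ ⊕ E_{k-1})`. -/
def Bperp {n : ℕ} (E : Fin n → ModuleCat.{u} A) (k : Fin n) (X : ModuleCat.{u} A) : Prop :=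
  ∀ j : Fin n, j < k → lperp (E j) X

/-- `X` is a projective object of the subcategory (given by the predicate) `C`. -/
def ProjIn (C : ModuleCat.{u} A → Prop) (X : ModuleCat.{u} A) : Prop :=
  C X ∧ ∀ (Y Z : ModuleCat.{u} A), C Y → C Z → ∀ p : Y ⟶ Z, Epi p →
    ∀ f : X ⟶ Z, ∃ g : X ⟶ Y, g ≫ p = f

/-- `X` is an injective object of the subcategory (given by the predicate) `C`. -/
def InjIn (C : ModuleCat.{u} A → Prop) (X : ModuleCat.{u} A) : Prop :=
  C X ∧ ∀ (Y Z : ModuleCat.{u} A), C Y → C Z → ∀ i : Y ⟶ Z, Mono i →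
    ∀ f : Y ⟶ X, ∃ g : Z ⟶ X, i ≫ g = f

/-- `E k` is relatively projective in the exceptional sequence `E`. -/
def RelProj {n : ℕ} (E : Fin n → ModuleCat.{u} A) (k : Fin n) : Prop :=
  ProjIn (Aperp E k) (E k)

/-- `E k` is relatively injective in the exceptional sequence `E`. -/
def RelInj {n : ℕ} (E : Fin n → ModuleCat.{u} A) (k : Fin n) : Prop :=
  InjIn (Bperp E k) (E k)

/-- `Λ` is hereditary: every submodule of a projective module is projective. -/
def Hereditary (A : Type u) [Ring A] : Prop :=
  ∀ (P : ModuleCat.{u} A), Projective P →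
    ∀ S : Submodule A P, Projective (ModuleCat.of A S)

/-- The simple module `S` is in the support of `M`, i.e. `S` is (isomorphic to) a
composition factor (subquotient) of `M`. -/
def InSupport (S M : ModuleCat.{u} A) : Prop :=
  ∃ (N₁ N₂ : Submodule A M), N₁ ≤ N₂ ∧
    Nonempty ((ModuleCat.of A (N₂ ⧸ (Submodule.comap N₂.subtype N₁))) ≅ S)


section Basics

open Abelian

variable {M N L P Q W : Type u} [AddCommGroup M] [Module A M] [AddCommGroup N] [Module A N]
  [AddCommGroup L] [Module A L] [AddCommGroup P] [Module A P] [AddCommGroup Q] [Module A Q]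
  [AddCommGroup W] [Module A W]

/-- Ext vanishing, unbundled. -/
def X1 (A : Type u) [Ring A] (M N : Type u) [AddCommGroup M] [Module A M]
    [AddCommGroup N] [Module A N] : Prop :=
  Subsingleton (Ext (ModuleCat.of A M) (ModuleCat.of A N) 1)

/-- Hom vanishing, unbundled. -/
def H0 (A : Type u) [Ring A] (M N : Type u) [AddCommGroup M] [Module A M]
    [AddCommGroup N] [Module A N] : Prop := ∀ f : M →ₗ[A] N, f = 0

/-- short exact sequences, unbundled. -/
structure SES (f : M →ₗ[A] N) (g : N →ₗ[A] L) : Prop where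
  inj : Function.Injective f
  ex : Function.Exact f g
  surj : Function.Surjective g

/-- the short complex of a short exact sequence -/
def SES.sc {f : M →ₗ[A] N} {g : N →ₗ[A] L} (h : SES f g) : ShortComplex (ModuleCat.{u} A) :=
  ShortComplex.mk (ModuleCat.ofHom f) (ModuleCat.ofHom g) (by
    rw [← ModuleCat.ofHom_comp, h.ex.linearMap_comp_eq_zero]; rfl)

theorem SES.se {f : M →ₗ[A] N} {g : N →ₗ[A] L} (h : SES f g) : h.sc.ShortExact :=
  ModuleCat.shortComplex_shortExact _ h.ex h.inj h.surj

theorem SES.ker {g : N →ₗ[A] L} (hg : Function.Surjective g) : SES (LinearMap.ker g).subtype g :=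
  ⟨Subtype.val_injective, LinearMap.exact_subtype_ker_map g, hg⟩

theorem SES.sub (S : Submodule A N) : SES S.subtype S.mkQ :=
  ⟨Subtype.val_injective, LinearMap.exact_subtype_mkQ S, S.mkQ_surjective⟩

/-- lifting -/
theorem SES.lift {f : M →ₗ[A] N} {g : N →ₗ[A] L} (h : SES f g) (hX : X1 A W M)
    (k : W →ₗ[A] L) : ∃ l : W →ₗ[A] N, g ∘ₗ l = k := by
  have : Subsingleton (Ext (ModuleCat.of A W) h.sc.X₁ 1) := hX
  obtain ⟨x, hx⟩ := Ext.covariant_sequence_exact₃ (ModuleCat.of A W) h.se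
    (Ext.mk₀ (ModuleCat.ofHom k : ModuleCat.of A W ⟶ h.sc.X₃)) (zero_add 1) (Subsingleton.elim _ _)
  obtain ⟨y, rfl⟩ := Ext.homEquiv₀.symm.surjective x
  have h2 := Ext.homEquiv₀.symm.injective ((Ext.mk₀_comp_mk₀ y h.sc.g).symm.trans hx)
  exact ⟨y.hom, congrArg ModuleCat.Hom.hom h2⟩

/-- extension -/
theorem SES.extend {f : M →ₗ[A] N} {g : N →ₗ[A] L} (h : SES f g) (hX : X1 A L W)
    (k : M →ₗ[A] W) : ∃ l : N →ₗ[A] W, l ∘ₗ f = k := by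
  have : Subsingleton (Ext h.sc.X₃ (ModuleCat.of A W) 1) := hX
  obtain ⟨x, hx⟩ := Ext.contravariant_sequence_exact₁ h.se (ModuleCat.of A W)
    (Ext.mk₀ (ModuleCat.ofHom k : h.sc.X₁ ⟶ ModuleCat.of A W)) (add_zero 1) (Subsingleton.elim _ _)
  obtain ⟨y, rfl⟩ := Ext.homEquiv₀.symm.surjective x
  have h2 := Ext.homEquiv₀.symm.injective ((Ext.mk₀_comp_mk₀ h.sc.f y).symm.trans hx)
  exact ⟨y.hom, congrArg ModuleCat.Hom.hom h2⟩

theorem subsing_of {G : Type*} [AddGroup G] (h : ∀ x : G, x = 0) : Subsingleton G :=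
  ⟨fun a b => (h a).trans (h b).symm⟩

theorem SES.cov_mid {f : M →ₗ[A] N} {g : N →ₗ[A] L} (h : SES f g) (h1 : X1 A W M)
    (h3 : X1 A W L) : X1 A W N := by
  have : Subsingleton (Ext (ModuleCat.of A W) h.sc.X₁ 1) := h1
  have : Subsingleton (Ext (ModuleCat.of A W) h.sc.X₃ 1) := h3
  refine subsing_of fun x => ?_
  obtain ⟨y, hy⟩ := Ext.covariant_sequence_exact₂ (ModuleCat.of A W) h.se x (Subsingleton.elim _ _)
  rw [← hy, Subsingleton.elim y 0, Ext.zero_comp]; rfl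

theorem SES.con_mid {f : M →ₗ[A] N} {g : N →ₗ[A] L} (h : SES f g) (h1 : X1 A M W)
    (h3 : X1 A L W) : X1 A N W := by
  have : Subsingleton (Ext h.sc.X₁ (ModuleCat.of A W) 1) := h1
  have : Subsingleton (Ext h.sc.X₃ (ModuleCat.of A W) 1) := h3
  refine subsing_of fun x => ?_
  obtain ⟨y, hy⟩ := Ext.contravariant_sequence_exact₂ h.se (ModuleCat.of A W) x
    (Subsingleton.elim _ _)
  rw [← hy, Subsingleton.elim y 0, Ext.comp_zero]; rfl

theorem SES.con_right' {f : M →ₗ[A] N} {g : N →ₗ[A] L} (h : SES f g) (h2 : X1 A N W)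
    (h1 : ∀ k : M →ₗ[A] W, ∃ l : N →ₗ[A] W, l ∘ₗ f = k) : X1 A L W := by
  have : Subsingleton (Ext h.sc.X₂ (ModuleCat.of A W) 1) := h2
  refine subsing_of fun (x : Ext h.sc.X₃ (ModuleCat.of A W) 1) => ?_
  obtain ⟨y, hy⟩ := Ext.contravariant_sequence_exact₃ h.se (ModuleCat.of A W) x
    (Subsingleton.elim _ _) (n₀ := 0) rfl
  obtain ⟨k, rfl⟩ := Ext.homEquiv₀.symm.surjective y
  obtain ⟨l, hl⟩ := h1 k.hom
  let l' : h.sc.X₂ ⟶ ModuleCat.of A W := ModuleCat.ofHom l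
  have : k = h.sc.f ≫ l' := by
    ext1; exact hl.symm
  rw [← hy]
  have h3 : Ext.homEquiv₀.symm k = (Ext.mk₀ h.sc.f).comp (Ext.mk₀ l') (zero_add 0) := by
    rw [Ext.mk₀_comp_mk₀, this]; rfl
  rw [h3]
  exact ShortComplex.ShortExact.extClass_comp_assoc h.se _

theorem SES.con_right {f : M →ₗ[A] N} {g : N →ₗ[A] L} (h : SES f g) (h1 : H0 A M W)
    (h2 : X1 A N W) : X1 A L W :=
  h.con_right' h2 fun k => ⟨0, by rw [h1 k]; simp⟩

theorem SES.cov_left {f : M →ₗ[A] N} {g : N →ₗ[A] L} (h : SES f g) (h3 : H0 A W L)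
    (h2 : X1 A W N) : X1 A W M := by
  have : Subsingleton (Ext (ModuleCat.of A W) h.sc.X₂ 1) := h2
  refine subsing_of fun (x : Ext (ModuleCat.of A W) h.sc.X₁ 1) => ?_
  obtain ⟨y, hy⟩ := Ext.covariant_sequence_exact₁ (ModuleCat.of A W) h.se x
    (Subsingleton.elim _ _) (n₀ := 0) rfl
  obtain ⟨k, rfl⟩ := Ext.homEquiv₀.symm.surjective y
  have : k = 0 := by ext1; exact h3 k.hom
  subst this
  rw [← hy]
  change (Ext.mk₀ 0).comp _ _ = 0
  simp

theorem projdim2 (hA : Hereditary A) (M : Type u) [AddCommGroup M] [Module A M] :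
    HasProjectiveDimensionLT (ModuleCat.of A M) 2 := by
  have h := SES.ker (Finsupp.linearCombination_id_surjective A M)
  have hP : Projective (ModuleCat.of A (M →₀ A)) := inferInstance
  have h1 : Projective h.sc.X₁ := hA _ hP _
  have h2 : Projective h.sc.X₂ := hP
  exact h.se.hasProjectiveDimensionLT_X₃ 1 inferInstance inferInstance

theorem SES.cov_right (hA : Hereditary A) {f : M →ₗ[A] N} {g : N →ₗ[A] L} (h : SES f g)
    (h2 : X1 A W N) : X1 A W L := by
  have : Subsingleton (Ext (ModuleCat.of A W) h.sc.X₂ 1) := h2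
  have := projdim2 hA W
  refine subsing_of fun (x : Ext (ModuleCat.of A W) h.sc.X₃ 1) => ?_
  obtain ⟨y, hy⟩ := Ext.covariant_sequence_exact₃ (ModuleCat.of A W) h.se x (n₁ := 2) rfl
    (Ext.eq_zero_of_hasProjectiveDimensionLT _ 2 le_rfl)
  rw [← hy, Subsingleton.elim y 0, Ext.zero_comp]; rfl

theorem SES.con_left (hA : Hereditary A) {f : M →ₗ[A] N} {g : N →ₗ[A] L} (h : SES f g)
    (h2 : X1 A N W) : X1 A M W := by
  have : Subsingleton (Ext h.sc.X₂ (ModuleCat.of A W) 1) := h2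
  have : HasProjectiveDimensionLT h.sc.X₃ 2 := projdim2 hA L
  refine subsing_of fun (x : Ext h.sc.X₁ (ModuleCat.of A W) 1) => ?_
  obtain ⟨y, hy⟩ := Ext.contravariant_sequence_exact₁ h.se (ModuleCat.of A W) x (n₁ := 2) rfl
    (Ext.eq_zero_of_hasProjectiveDimensionLT _ 2 le_rfl)
  rw [← hy, Subsingleton.elim y 0, Ext.comp_zero]; rfl

theorem X1.of_proj [Module.Projective A P] : X1 A P W :=
  HasProjectiveDimensionLT.subsingleton (ModuleCat.of A P) 1 1 le_rfl _

/-- sections -/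
theorem SES.section {f : M →ₗ[A] N} {g : N →ₗ[A] L} (h : SES f g) (hX : X1 A L M) :
    ∃ s : L →ₗ[A] N, g ∘ₗ s = LinearMap.id := h.lift hX _

/-- pushouts -/
theorem SES.pushout {f : M →ₗ[A] N} {g : N →ₗ[A] L} (h : SES f g) (k : M →ₗ[A] W) :
    ∃ (E : Type u) (_ : AddCommGroup E) (_ : Module A E) (i : W →ₗ[A] E) (p : E →ₗ[A] L)
      (l : N →ₗ[A] E), SES i p ∧ p ∘ₗ l = g ∧ l ∘ₗ f = i ∘ₗ k ∧
      SES (LinearMap.prod (-k) f) (LinearMap.coprod i l) := by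
  let d : M →ₗ[A] W × N := LinearMap.prod (-k) f
  let S := LinearMap.range d
  let p0 : W × N →ₗ[A] L := g ∘ₗ LinearMap.snd A W N
  have hS : S ≤ LinearMap.ker p0 := by
    rintro _ ⟨m, rfl⟩
    exact h.ex.apply_apply_eq_zero m
  refine ⟨(W × N) ⧸ S, inferInstance, inferInstance, S.mkQ ∘ₗ LinearMap.inl A W N,
    S.liftQ p0 hS, S.mkQ ∘ₗ LinearMap.inr A W N, ⟨?_, ?_, ?_⟩, ?_, ?_, ⟨?_, ?_, ?_⟩⟩
  · rw [← LinearMap.ker_eq_bot, LinearMap.ker_eq_bot']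
    intro w hw
    simp only [LinearMap.comp_apply, Submodule.mkQ_apply, Submodule.Quotient.mk_eq_zero] at hw
    obtain ⟨m, hm⟩ := hw
    have h1 : f m = 0 := congrArg Prod.snd hm
    have h2 : -k m = w := congrArg Prod.fst hm
    have : m = 0 := h.inj (by simpa using h1)
    subst this
    simpa using h2.symm
  · intro x
    obtain ⟨⟨w, n⟩, rfl⟩ := S.mkQ_surjective x
    constructor
    · intro hx
      have hx' : g n = 0 := hx
      obtain ⟨m, rfl⟩ := (h.ex n).1 hx'
      refine ⟨w + k m, ?_⟩
      simp only [LinearMap.comp_apply, Submodule.mkQ_apply]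
      rw [Submodule.Quotient.eq]
      exact ⟨-m, by ext <;> simp [d]⟩
    · rintro ⟨w', hw'⟩
      rw [← hw']
      change g 0 = 0
      simp
  · intro x
    obtain ⟨n, rfl⟩ := h.surj x
    exact ⟨S.mkQ (0, n), rfl⟩
  · ext n; rfl
  · ext m
    simp only [LinearMap.comp_apply, Submodule.mkQ_apply]
    rw [Submodule.Quotient.eq]
    exact ⟨m, by ext <;> simp [d]⟩
  · intro a b hab
    exact h.inj (congrArg Prod.snd hab)
  · have : LinearMap.coprod (S.mkQ ∘ₗ LinearMap.inl A W N) (S.mkQ ∘ₗ LinearMap.inr A W N)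
        = S.mkQ := by
      ext <;> simp
    rw [this]
    intro x
    rw [Submodule.mkQ_apply, Submodule.Quotient.mk_eq_zero]
    rfl
  · have : LinearMap.coprod (S.mkQ ∘ₗ LinearMap.inl A W N) (S.mkQ ∘ₗ LinearMap.inr A W N)
        = S.mkQ := by
      ext <;> simp
    rw [this]
    exact S.mkQ_surjective

/-- retraction from section -/
theorem SES.retract {f : M →ₗ[A] N} {g : N →ₗ[A] L} (h : SES f g) (s : L →ₗ[A] N)
    (hs : g ∘ₗ s = LinearMap.id) : ∃ r : N →ₗ[A] M, r ∘ₗ f = LinearMap.id := by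
  have : (∃ l : L →ₗ[A] N, g ∘ₗ l = LinearMap.id) ↔ (∃ l : N →ₗ[A] M, l ∘ₗ f = LinearMap.id) :=
    (h.ex.split_tfae h.inj h.surj).out 0 1
  exact this.1 ⟨s, hs⟩

theorem homZero_iff (X Y : ModuleCat.{u} A) : homZero X Y ↔ H0 A X Y :=
  ⟨fun h f => congrArg ModuleCat.Hom.hom (h (ModuleCat.ofHom f)),
    fun h f => by ext1; exact h f.hom⟩

theorem extZero_iff (X Y : ModuleCat.{u} A) : extZero X Y ↔ X1 A X Y := by
  constructor
  · intro h
    have hP := SES.ker (Finsupp.linearCombination_id_surjective A X)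
    refine hP.con_right' X1.of_proj fun k => ?_
    obtain ⟨E, _, _, i, p, l, hs, h1, h2, -⟩ := hP.pushout k
    obtain ⟨s, hs'⟩ := h (ModuleCat.of A E) (ModuleCat.ofHom i) (ModuleCat.ofHom p) hs.sc.zero hs.se
    obtain ⟨r, hr⟩ := hs.retract s.hom (congrArg ModuleCat.Hom.hom hs')
    refine ⟨r ∘ₗ l, ?_⟩
    rw [LinearMap.comp_assoc, h2, ← LinearMap.comp_assoc, hr, LinearMap.id_comp]
  · intro h E i p w hse
    have hs : SES i.hom p.hom := ⟨hse.moduleCat_injective_f,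
      (ShortComplex.ShortExact.moduleCat_exact_iff_function_exact _).1 hse.exact,
      hse.moduleCat_surjective_g⟩
    obtain ⟨s, hs⟩ := hs.section h
    exact ⟨ModuleCat.ofHom s, by ext1; exact hs⟩

theorem X1.pi_left {ι : Type} [Fintype ι] [DecidableEq ι] (h : X1 A M W) : X1 A (ι → M) W := by
  refine (extZero_iff (ModuleCat.of A (ι → M)) (ModuleCat.of A W)).1 fun E i p w hse => ?_
  have hs : SES i.hom p.hom := ⟨hse.moduleCat_injective_f,
      (ShortComplex.ShortExact.moduleCat_exact_iff_function_exact _).1 hse.exact,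
      hse.moduleCat_surjective_g⟩
  have := fun j : ι => hs.lift h (LinearMap.single A (fun _ : ι => M) j)
  choose l hl using this
  refine ⟨ModuleCat.ofHom (∑ j, l j ∘ₗ LinearMap.proj j), ?_⟩
  ext1
  change p.hom ∘ₗ (∑ j, l j ∘ₗ LinearMap.proj j) = LinearMap.id
  refine LinearMap.ext fun x => ?_
  have : ∀ j, p.hom (l j (x j)) = Pi.single j (x j) := fun j => LinearMap.congr_fun (hl j) (x j)
  simp only [LinearMap.comp_apply, LinearMap.sum_apply, map_sum, LinearMap.proj_apply, this,
    LinearMap.id_apply]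
  exact Finset.univ_sum_single x

theorem X1.pi_right {ι : Type} [Fintype ι] (h : X1 A W M) : X1 A W (ι → M) := by
  refine (extZero_iff (ModuleCat.of A W) (ModuleCat.of A (ι → M))).1 fun E i p w hse => ?_
  have hs : SES i.hom p.hom := ⟨hse.moduleCat_injective_f,
      (ShortComplex.ShortExact.moduleCat_exact_iff_function_exact _).1 hse.exact,
      hse.moduleCat_surjective_g⟩
  have := fun j : ι => hs.extend h (LinearMap.proj j)
  choose l hl using this
  have h0 : (LinearMap.pi l) ∘ₗ i.hom = LinearMap.id := by
    ext1 x
    funext j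
    exact LinearMap.congr_fun (hl j) x
  have h3 : (∃ l : W →ₗ[A] E, p.hom ∘ₗ l = LinearMap.id) ↔
      (∃ l : E →ₗ[A] (ι → M), l ∘ₗ i.hom = LinearMap.id) :=
    (hs.ex.split_tfae hs.inj hs.surj).out 0 1
  obtain ⟨s, hs⟩ := h3.2 ⟨_, h0⟩
  exact ⟨ModuleCat.ofHom s, by ext1; exact hs⟩

theorem H0.pi_left {ι : Type} [Fintype ι] [DecidableEq ι] (h : H0 A M W) : H0 A (ι → M) W := by
  intro f
  refine LinearMap.pi_ext' fun j => ?_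
  rw [h (f ∘ₗ LinearMap.single A (fun _ : ι => M) j)]; simp

theorem H0.pi_right {ι : Type} (h : H0 A W M) : H0 A W (ι → M) := by
  intro f
  ext x j
  exact LinearMap.congr_fun (h (LinearMap.proj j ∘ₗ f)) x

theorem H0.of_surj {g : N →ₗ[A] L} (hg : Function.Surjective g) (h : H0 A N W) : H0 A L W := by
  intro f
  ext x
  obtain ⟨y, rfl⟩ := hg x
  exact LinearMap.congr_fun (h (f ∘ₗ g)) y

theorem H0.of_inj {g : M →ₗ[A] N} (hg : Function.Injective g) (h : H0 A W N) : H0 A W M := by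
  intro f
  ext x
  apply hg
  simpa using LinearMap.congr_fun (h (g ∘ₗ f)) x

theorem SES.H0_con {f : M →ₗ[A] N} {g : N →ₗ[A] L} (h : SES f g) (h1 : H0 A M W)
    (h3 : H0 A L W) : H0 A N W := by
  intro k
  have hk := h1 (k ∘ₗ f)
  ext x
  have : LinearMap.ker g ≤ LinearMap.ker k := by
    intro y hy
    obtain ⟨z, rfl⟩ := (h.ex y).1 hy
    exact LinearMap.congr_fun hk z
  obtain ⟨e, he⟩ : ∃ e : L →ₗ[A] W, e ∘ₗ g = k := by
    refine ⟨(LinearMap.ker g).liftQ k this ∘ₗ (g.quotKerEquivOfSurjective h.surj).symm, ?_⟩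
    ext y
    have : (g.quotKerEquivOfSurjective h.surj).symm (g y) = (LinearMap.ker g).mkQ y := by
      rw [LinearEquiv.symm_apply_eq]; rfl
    simp [this]
  rw [← he, h3 e]; simp

theorem SES.H0_cov {f : M →ₗ[A] N} {g : N →ₗ[A] L} (h : SES f g) (h1 : H0 A W M)
    (h3 : H0 A W L) : H0 A W N := by
  intro k
  have hk := h3 (g ∘ₗ k)
  ext x
  obtain ⟨y, hy⟩ : ∃ e : W →ₗ[A] M, f ∘ₗ e = k := by
    have hr : ∀ x, k x ∈ LinearMap.range f := fun x => (h.ex _).1 (LinearMap.congr_fun hk x)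
    refine ⟨(LinearEquiv.ofInjective f h.inj).symm.toLinearMap ∘ₗ k.codRestrict _ hr, ?_⟩
    ext x
    have := congrArg Subtype.val ((LinearEquiv.ofInjective f h.inj).apply_symm_apply (k.codRestrict _ hr x))
    exact this
  rw [← hy, h1 y]; simp

end Basics

set_option linter.unusedSectionVars false

section Dims

variable (K : Type u) [Field K] [Algebra K A] [FiniteDimensional K A]
variable {M N L P Q W : Type u} [AddCommGroup M] [Module A M] [AddCommGroup N] [Module A N]
  [AddCommGroup L] [Module A L] [AddCommGroup P] [Module A P] [AddCommGroup Q] [Module A Q]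
  [AddCommGroup W] [Module A W]

/-- central scalar multiplication -/
def sm (c : K) : N →ₗ[A] N where
  toFun x := algebraMap K A c • x
  map_add' x y := smul_add _ x y
  map_smul' a x := by
    simp only [RingHom.id_apply, smul_smul]; rw [Algebra.commutes]

theorem sm_comm (c : K) (f : M →ₗ[A] N) : f ∘ₗ sm K c = sm K c ∘ₗ f := by
  ext x; simp [sm]

theorem finHom [Module K M] [IsScalarTower K A M] [Module K N] [IsScalarTower K A N]
    [Module.Finite A M] [Module.Finite A N] : Module.Finite K (M →ₗ[A] N) := by
  have : Module.Finite K M := Module.Finite.trans A M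
  have : Module.Finite K N := Module.Finite.trans A N
  exact Module.Finite.of_injective (LinearMap.restrictScalarsₗ K A M N K)
    (LinearMap.restrictScalars_injective K)

theorem fin_gen (M N : Type u) [AddCommGroup M] [Module A M] [AddCommGroup N] [Module A N]
    [Module.Finite A M] [Module.Finite A N] :
    ∃ (n : ℕ) (f : Fin n → (M →ₗ[A] N)), ∀ g : M →ₗ[A] N, ∃ c : Fin n → K,
      g = ∑ i, sm K (c i) ∘ₗ f i := by
  let := Module.restrictScalars K A M
  let := Module.restrictScalars K A N
  have := IsScalarTower.restrictScalars K A M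
  have := IsScalarTower.restrictScalars K A N
  have := finHom (A := A) K (M := M) (N := N)
  obtain ⟨n, f, hf⟩ := Module.Finite.exists_fin (R := K) (M := M →ₗ[A] N)
  refine ⟨n, f, fun g => ?_⟩
  have hg : g ∈ Submodule.span K (Set.range f) := hf ▸ Submodule.mem_top
  obtain ⟨c, hc⟩ := (Submodule.mem_span_range_iff_exists_fun K).1 hg
  refine ⟨c, hc.symm.trans (Finset.sum_congr rfl fun i _ => ?_)⟩
  ext x
  simp only [LinearMap.smul_apply, LinearMap.comp_apply, sm, LinearMap.coe_mk, AddHom.coe_mk]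
  rw [algebraMap_smul]

/-- dimension of Hom -/
noncomputable def hd (A : Type u) [Ring A] [Algebra K A] (M N : Type u) [AddCommGroup M] [Module A M] [AddCommGroup N] [Module A N] :
    ℕ :=
  letI := Module.restrictScalars K A N
  haveI := IsScalarTower.restrictScalars K A N
  Module.finrank K (M →ₗ[A] N)

/-- dimension -/
noncomputable def dm (A : Type u) [Ring A] [Algebra K A] (N : Type u) [AddCommGroup N]
    [Module A N] : ℕ :=
  letI := Module.restrictScalars K A N
  Module.finrank K N

theorem hd_ses {f : Q →ₗ[A] P} {g : P →ₗ[A] M} (h : SES f g) [Module.Finite A P]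
    [Module.Finite A N] (hX : X1 A M N) : hd K A P N = hd K A M N + hd K A Q N := by
  let := Module.restrictScalars K A N
  have := IsScalarTower.restrictScalars K A N
  let := Module.restrictScalars K A P
  have := IsScalarTower.restrictScalars K A P
  have := finHom (A := A) K (M := P) (N := N)
  let r : (P →ₗ[A] N) →ₗ[K] (Q →ₗ[A] N) :=
    { toFun := fun k => k ∘ₗ f, map_add' := fun _ _ => rfl, map_smul' := fun _ _ => rfl }
  let s : (M →ₗ[A] N) →ₗ[K] (P →ₗ[A] N) :=
    { toFun := fun k => k ∘ₗ g, map_add' := fun _ _ => rfl, map_smul' := fun _ _ => rfl }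
  have hr : Function.Surjective r := fun k => h.extend hX k
  have hs : Function.Injective s := fun a b hab => by
    ext x
    obtain ⟨y, rfl⟩ := h.surj x
    exact LinearMap.congr_fun hab y
  have hk : LinearMap.ker r = LinearMap.range s := by
    ext k
    constructor
    · intro hk
      have hle : LinearMap.ker g ≤ LinearMap.ker k := by
        intro y hy
        obtain ⟨z, rfl⟩ := (h.ex y).1 hy
        exact LinearMap.congr_fun (show k ∘ₗ f = 0 from hk) z
      refine ⟨(LinearMap.ker g).liftQ k hle ∘ₗ (g.quotKerEquivOfSurjective h.surj).symm, ?_⟩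
      refine LinearMap.ext fun y => ?_
      have : (g.quotKerEquivOfSurjective h.surj).symm (g y) = (LinearMap.ker g).mkQ y := by
        rw [LinearEquiv.symm_apply_eq]; rfl
      simp [s, this]
    · rintro ⟨k, rfl⟩
      refine LinearMap.ext fun y => ?_
      change k (g (f y)) = 0
      rw [h.ex.apply_apply_eq_zero, map_zero]
  have h1 := LinearMap.finrank_range_add_finrank_ker r
  rw [LinearMap.range_eq_top.2 hr, finrank_top, hk, LinearMap.finrank_range_of_inj hs] at h1
  change Module.finrank K (P →ₗ[A] N) = Module.finrank K (M →ₗ[A] N) + Module.finrank K (Q →ₗ[A] N)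
  omega

theorem hd_le {f : Q →ₗ[A] P} {g : P →ₗ[A] M} (h : SES f g) [Module.Finite A Q]
    [Module.Finite A N] (hX : H0 A M N) : hd K A P N ≤ hd K A Q N := by
  let := Module.restrictScalars K A N
  have := IsScalarTower.restrictScalars K A N
  let := Module.restrictScalars K A Q
  have := IsScalarTower.restrictScalars K A Q
  have := finHom (A := A) K (M := Q) (N := N)
  let r : (P →ₗ[A] N) →ₗ[K] (Q →ₗ[A] N) :=
    { toFun := fun k => k ∘ₗ f, map_add' := fun _ _ => rfl, map_smul' := fun _ _ => rfl }
  have hr : Function.Injective r := by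
    rw [← LinearMap.ker_eq_bot, LinearMap.ker_eq_bot']
    intro k hk
    have hle : LinearMap.ker g ≤ LinearMap.ker k := by
      intro y hy
      obtain ⟨z, rfl⟩ := (h.ex y).1 hy
      exact LinearMap.congr_fun (show k ∘ₗ f = 0 from hk) z
    have h0 := hX ((LinearMap.ker g).liftQ k hle ∘ₗ (g.quotKerEquivOfSurjective h.surj).symm)
    refine LinearMap.ext fun y => ?_
    have : (g.quotKerEquivOfSurjective h.surj).symm (g y) = (LinearMap.ker g).mkQ y := by
      rw [LinearEquiv.symm_apply_eq]; rfl
    have h2 := LinearMap.congr_fun h0 (g y)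
    simpa [this] using h2
  exact LinearMap.finrank_le_finrank_of_injective hr

theorem hd_zero (hX : H0 A M N) : hd K A M N = 0 := by
  let := Module.restrictScalars K A N
  have := IsScalarTower.restrictScalars K A N
  have : Subsingleton (M →ₗ[A] N) := subsing_of hX
  exact Module.finrank_zero_of_subsingleton

theorem hd_pos [Module.Finite A M] [Module.Finite A N] (hX : ¬ H0 A M N) : 0 < hd K A M N := by
  let := Module.restrictScalars K A N
  have := IsScalarTower.restrictScalars K A N
  let := Module.restrictScalars K A M
  have := IsScalarTower.restrictScalars K A M
  have := finHom (A := A) K (M := M) (N := N)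
  obtain ⟨f, hf⟩ := not_forall.1 hX
  exact Module.finrank_pos_iff_exists_ne_zero.2 ⟨f, hf⟩

theorem hd_congr (e : M ≃ₗ[A] L) : hd K A M N = hd K A L N := by
  let := Module.restrictScalars K A N
  have := IsScalarTower.restrictScalars K A N
  exact LinearEquiv.finrank_eq (LinearEquiv.congrLeft N K e)

theorem dm_ses {f : Q →ₗ[A] P} {g : P →ₗ[A] M} (h : SES f g) [Module.Finite A P] :
    dm K A P = dm K A Q + dm K A M := by
  let := Module.restrictScalars K A P
  have := IsScalarTower.restrictScalars K A P
  let := Module.restrictScalars K A Q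
  have := IsScalarTower.restrictScalars K A Q
  let := Module.restrictScalars K A M
  have := IsScalarTower.restrictScalars K A M
  have : Module.Finite K P := Module.Finite.trans A P
  have h1 := LinearMap.finrank_range_add_finrank_ker (g.restrictScalars K)
  have h2 : LinearMap.ker (g.restrictScalars K) = LinearMap.range (f.restrictScalars K) :=
    SetLike.ext fun y => h.ex y
  have h3 : LinearMap.range (g.restrictScalars K) = ⊤ := LinearMap.range_eq_top.2 h.surj
  have h4 : Module.finrank K (LinearMap.range (f.restrictScalars K)) = Module.finrank K Q :=
    LinearMap.finrank_range_of_inj h.inj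
  rw [h3, finrank_top, h2, h4] at h1
  change Module.finrank K P = Module.finrank K Q + Module.finrank K M
  omega

theorem dm_pos [Module.Finite A M] [Nontrivial M] : 0 < dm K A M := by
  let := Module.restrictScalars K A M
  have := IsScalarTower.restrictScalars K A M
  have : Module.Finite K M := Module.Finite.trans A M
  exact Module.finrank_pos (R := K) (M := M)

theorem surj_of_dm [Module.Finite A N] [Module.Finite A M] {f : M →ₗ[A] N}
    (hf : Function.Injective f) (h : dm K A N ≤ dm K A M) : Function.Surjective f := by
  have h1 : SES f (LinearMap.range f).mkQ :=
    ⟨hf, LinearMap.exact_map_mkQ_range f, Submodule.mkQ_surjective _⟩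
  have h2 := dm_ses K h1
  by_contra hn
  have : Nontrivial (N ⧸ LinearMap.range f) := by
    rw [Submodule.Quotient.nontrivial_iff]
    exact fun h => hn (LinearMap.range_eq_top.1 h)
  have := dm_pos (A := A) K (M := N ⧸ LinearMap.range f)
  omega

end Dims

section Constr

variable {M N L P Q W : Type u} [AddCommGroup M] [Module A M] [AddCommGroup N] [Module A N]
  [AddCommGroup L] [Module A L] [AddCommGroup P] [Module A P] [AddCommGroup Q] [Module A Q]
  [AddCommGroup W] [Module A W]

theorem SES.pi {f : M →ₗ[A] N} {g : N →ₗ[A] L} (h : SES f g) (ι : Type) :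
    SES (f.compLeft ι) (g.compLeft ι) := by
  refine ⟨fun a b hab => funext fun j => h.inj (congrFun hab j), fun x => ⟨fun hx => ?_, ?_⟩,
    fun x => ?_⟩
  · have := fun j => (h.ex (x j)).1 (congrFun hx j)
    choose y hy using this
    exact ⟨y, funext hy⟩
  · rintro ⟨y, rfl⟩
    exact funext fun j => h.ex.apply_apply_eq_zero (y j)
  · have := fun j => h.surj (x j)
    choose y hy using this
    exact ⟨y, funext hy⟩

theorem SES.factor_ker {f : M →ₗ[A] N} {g : N →ₗ[A] L} (h : SES f g) (k : W →ₗ[A] N)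
    (hk : g ∘ₗ k = 0) : ∃ e : W →ₗ[A] M, f ∘ₗ e = k := by
  have hr : ∀ x, k x ∈ LinearMap.range f := fun x => (h.ex _).1 (LinearMap.congr_fun hk x)
  refine ⟨(LinearEquiv.ofInjective f h.inj).symm.toLinearMap ∘ₗ k.codRestrict _ hr, ?_⟩
  ext x
  exact congrArg Subtype.val
    ((LinearEquiv.ofInjective f h.inj).apply_symm_apply (k.codRestrict _ hr x))

theorem SES.factor_coker {f : M →ₗ[A] N} {g : N →ₗ[A] L} (h : SES f g) (k : N →ₗ[A] W)
    (hk : k ∘ₗ f = 0) : ∃ e : L →ₗ[A] W, e ∘ₗ g = k := by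
  have hle : LinearMap.ker g ≤ LinearMap.ker k := by
    intro y hy
    obtain ⟨z, rfl⟩ := (h.ex y).1 hy
    exact LinearMap.congr_fun hk z
  refine ⟨(LinearMap.ker g).liftQ k hle ∘ₗ (g.quotKerEquivOfSurjective h.surj).symm, ?_⟩
  ext y
  have : (g.quotKerEquivOfSurjective h.surj).symm (g y) = (LinearMap.ker g).mkQ y := by
    rw [LinearEquiv.symm_apply_eq]; rfl
  simp [this]

theorem SES.range (F : N →ₗ[A] L) : SES (LinearMap.ker F).subtype F.rangeRestrict := by
  refine ⟨Subtype.val_injective, fun x => ?_, F.surjective_rangeRestrict⟩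
  constructor
  · intro hx
    exact ⟨⟨x, congrArg Subtype.val hx⟩, rfl⟩
  · rintro ⟨y, rfl⟩
    exact Subtype.ext y.2

theorem noeth (K : Type u) [Field K] [Algebra K A] [FiniteDimensional K A]
    : IsNoetherianRing A := IsNoetherianRing.of_finite K A

theorem univ_ext_right (K : Type u) [Field K] [Algebra K A] [FiniteDimensional K A]
    (T Y : Type u) [AddCommGroup T] [Module A T] [AddCommGroup Y]
    [Module A Y] [Module.Finite A T] [Module.Finite A Y] (hT : X1 A T T) :
    ∃ (M : Type u) (_ : AddCommGroup M) (_ : Module A M) (n : ℕ) (i : Y →ₗ[A] M)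
      (p : M →ₗ[A] (Fin n → T)), SES i p ∧ Module.Finite A M ∧ X1 A T M := by
  have := noeth (A := A) K
  obtain ⟨r, g, hg⟩ := Module.Finite.exists_fin' A T
  have hP := SES.ker hg
  obtain ⟨n, f, hf⟩ := fin_gen (A := A) K (LinearMap.ker g) Y
  obtain ⟨M, _, _, i, p, l, hs, h1, h2, h3⟩ :=
    (hP.pi (Fin n)).pushout (∑ j, f j ∘ₗ LinearMap.proj j)
  refine ⟨M, inferInstance, inferInstance, n, i, p, hs, Module.Finite.of_surjective _ h3.surj, ?_⟩
  refine hP.con_right' X1.of_proj fun q => ?_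
  obtain ⟨e, he⟩ := hP.extend hT.pi_right (p ∘ₗ q)
  obtain ⟨e', he'⟩ := Module.projective_lifting_property p e hs.surj
  obtain ⟨y, hy⟩ := hs.factor_ker (q - e' ∘ₗ (LinearMap.ker g).subtype) (by
    rw [LinearMap.comp_sub, ← LinearMap.comp_assoc, he', he, sub_self])
  obtain ⟨c, hc⟩ := hf y
  refine ⟨e' + ∑ j, sm K (c j) ∘ₗ l ∘ₗ LinearMap.single A (fun _ => Fin r → A) j, ?_⟩
  have hq : q = e' ∘ₗ (LinearMap.ker g).subtype + i ∘ₗ y := by rw [hy]; abel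
  rw [hq, LinearMap.add_comp]
  congr 1
  refine LinearMap.ext fun x => ?_
  rw [hc]
  simp only [LinearMap.comp_apply, LinearMap.sum_apply, map_sum]
  refine Finset.sum_congr rfl fun j _ => ?_
  rw [show i (sm K (c j) (f j x)) = sm K (c j) (i (f j x)) from
    LinearMap.congr_fun (sm_comm K (c j) i) (f j x)]
  congr 1
  have h4 := LinearMap.congr_fun h2 (Pi.single j x)
  simp only [LinearMap.comp_apply, LinearMap.sum_apply, LinearMap.proj_apply] at h4
  have h5 : ∑ j', f j' ((Pi.single j x : Fin n → LinearMap.ker g) j') = f j x := by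
    rw [Finset.sum_eq_single j]
    · simp
    · intro b _ hb; simp [Pi.single_eq_of_ne hb]
    · simp
  rw [h5] at h4
  rw [← h4]
  congr 1
  funext a
  rcases eq_or_ne a j with rfl | ha
  · simp
  · simp [Pi.single_eq_of_ne ha]

theorem univ_ext_left (K : Type u) [Field K] [Algebra K A] [FiniteDimensional K A]
    (I E : Type u) [AddCommGroup I] [Module A I] [AddCommGroup E]
    [Module A E] [Module.Finite A I] [Module.Finite A E] (hE : X1 A E E) :
    ∃ (M : Type u) (_ : AddCommGroup M) (_ : Module A M) (n : ℕ) (i : (Fin n → E) →ₗ[A] M)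
      (p : M →ₗ[A] I), SES i p ∧ Module.Finite A M ∧ X1 A M E := by
  have := noeth (A := A) K
  obtain ⟨r, g, hg⟩ := Module.Finite.exists_fin' A I
  have hP := SES.ker hg
  obtain ⟨n, f, hf⟩ := fin_gen (A := A) K (LinearMap.ker g) E
  obtain ⟨M, _, _, i, p, l, hs, h1, h2, h3⟩ := hP.pushout (LinearMap.pi f)
  refine ⟨M, inferInstance, inferInstance, n, i, p, hs, Module.Finite.of_surjective _ h3.surj, ?_⟩
  refine h3.con_right' ?_ fun q => ?_
  · have hpr : SES (LinearMap.inl A (Fin n → E) (Fin r → A)) (LinearMap.snd A _ _) :=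
      ⟨LinearMap.inl_injective, Function.Exact.inl_snd,
        LinearMap.snd_surjective⟩
    exact hpr.con_mid hE.pi_left X1.of_proj
  · obtain ⟨c, hc⟩ := hf q
    refine ⟨LinearMap.coprod (-∑ j, sm K (c j) ∘ₗ LinearMap.proj j) 0, ?_⟩
    refine LinearMap.ext fun x => ?_
    rw [hc]
    simp

theorem constr_right (K : Type u) [Field K] [Algebra K A] [FiniteDimensional K A]
    (hA : Hereditary A) (T Y : Type u) [AddCommGroup T] [Module A T]
    [AddCommGroup Y] [Module A Y] [Module.Finite A T] [Module.Finite A Y]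
    [Module.Projective A Y] (hT : X1 A T T) :
    ∃ (X' : Type u) (_ : AddCommGroup X') (_ : Module A X'), Module.Finite A X' ∧
      H0 A T X' ∧ X1 A T X' ∧
      ∀ (W : Type u) [AddCommGroup W] [Module A W], H0 A T W → X1 A T W →
        X1 A X' W ∧ (H0 A X' W ↔ H0 A Y W) := by
  obtain ⟨M, _, _, n, i, p, hs, hM, hTM⟩ := univ_ext_right (A := A) K T Y hT
  obtain ⟨b, f, hf⟩ := fin_gen (A := A) K T M
  let F : (Fin b → T) →ₗ[A] M := ∑ j, f j ∘ₗ LinearMap.proj j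
  have hF : ∀ j t, F (Pi.single j t) = f j t := by
    intro j t
    simp only [F, LinearMap.comp_apply, LinearMap.sum_apply, LinearMap.proj_apply]
    rw [Finset.sum_eq_single j]
    · simp
    · intro b _ hb; simp [Pi.single_eq_of_ne hb]
    · simp
  have hN := SES.sub (LinearMap.range F)
  refine ⟨M ⧸ LinearMap.range F, inferInstance, inferInstance, inferInstance, ?_,
    hN.cov_right hA hTM, ?_⟩
  · intro k
    obtain ⟨l, hl⟩ := hN.lift ((SES.range F).cov_right hA hT.pi_right) k
    obtain ⟨c, hc⟩ := hf l
    ext t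
    rw [← hl, LinearMap.comp_apply, LinearMap.zero_apply, Submodule.mkQ_apply,
      Submodule.Quotient.mk_eq_zero, hc, LinearMap.sum_apply]
    refine Submodule.sum_mem _ fun j _ => ?_
    refine Submodule.smul_mem _ _ ?_
    exact ⟨_, hF j t⟩
  · intro W _ _ h0 h1
    have hNW : H0 A (LinearMap.range F) W :=
      H0.of_surj F.surjective_rangeRestrict h0.pi_left
    have hMW : X1 A M W := hs.con_mid X1.of_proj h1.pi_left
    refine ⟨hN.con_right hNW hMW, fun h k => ?_, fun h => ?_⟩
    · obtain ⟨l, hl⟩ := hs.extend h1.pi_left k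
      obtain ⟨e, he⟩ := hN.factor_coker l (hNW _)
      rw [← hl, ← he, h e]; simp
    · exact H0.of_surj hN.surj (hs.H0_con h h0.pi_left)

theorem constr_left (K : Type u) [Field K] [Algebra K A] [FiniteDimensional K A]
    (hA : Hereditary A) (I E : Type u) [AddCommGroup I] [Module A I]
    [AddCommGroup E] [Module A E] [Module.Finite A I] [Module.Finite A E]
    (hE : X1 A E E) :
    ∃ (J : Type u) (_ : AddCommGroup J) (_ : Module A J), Module.Finite A J ∧
      H0 A J E ∧ X1 A J E ∧
      (∀ (W : Type u) [AddCommGroup W] [Module A W], H0 A W E → X1 A W E →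
        (X1 A W I → X1 A W J) ∧ (H0 A W J ↔ H0 A W I)) ∧
      (∀ (W : Type u) [AddCommGroup W] [Module A W], H0 A E W → X1 A E W → H0 A I W → X1 A I W →
        H0 A J W ∧ X1 A J W) := by
  have := noeth (A := A) K
  obtain ⟨M, _, _, n, i, p, hs, hM, hME⟩ := univ_ext_left (A := A) K I E hE
  obtain ⟨b, f, hf⟩ := fin_gen (A := A) K M E
  let F : M →ₗ[A] (Fin b → E) := LinearMap.pi f
  have hR := SES.range F
  have hR2 := SES.sub (LinearMap.range F)
  refine ⟨LinearMap.ker F, inferInstance, inferInstance, inferInstance, ?_,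
    hR.con_left hA hME, ?_, ?_⟩
  · intro k
    obtain ⟨l, hl⟩ := hR.extend (hR2.con_left hA hE.pi_left) k
    obtain ⟨c, hc⟩ := hf l
    ext t
    rw [← hl, hc]
    have : ∀ j, f j t = 0 := fun j => congrFun t.2 j
    simp [this]
  · intro W _ _ h0 h1
    have hRW : H0 A W (LinearMap.range F) :=
      H0.of_inj (g := (LinearMap.range F).subtype) Subtype.val_injective h0.pi_right
    refine ⟨fun h => hR.cov_left hRW (hs.cov_mid h1.pi_right h), fun h k => ?_, fun h => ?_⟩
    · obtain ⟨l, hl⟩ := hs.lift h1.pi_right k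
      obtain ⟨e, he⟩ := hR.factor_ker l (hRW _)
      rw [← hl, ← he, h e]; simp
    · exact H0.of_inj hR.inj (hs.H0_cov h0.pi_right h)
  · intro W _ _ h0 h1 h2 h3
    have hMW := hs.con_mid h1.pi_left h3
    refine ⟨fun k => ?_, hR.con_left hA hMW⟩
    obtain ⟨l, hl⟩ := hR.extend (hR2.con_left hA h1.pi_left) k
    rw [← hl, hs.H0_con h0.pi_left h2 l]; simp

theorem constr_left_seq (K : Type u) [Field K] [Algebra K A] [FiniteDimensional K A]
    (hA : Hereditary A) (I : Type u) [AddCommGroup I] [Module A I]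
    [Module.Finite A I] (hI : ∀ (W : Type u) [AddCommGroup W] [Module A W], X1 A W I) (m : ℕ) :
    ∀ (E : Fin m → ModuleCat.{u} A), (∀ i, Module.Finite A (E i)) → (∀ i, X1 A (E i) (E i)) →
      (∀ i j, i < j → H0 A (E j) (E i) ∧ X1 A (E j) (E i)) →
    ∃ (J : Type u) (_ : AddCommGroup J) (_ : Module A J), Module.Finite A J ∧
      (∀ i, H0 A J (E i) ∧ X1 A J (E i)) ∧
      (∀ (W : Type u) [AddCommGroup W] [Module A W], (∀ i, H0 A W (E i) ∧ X1 A W (E i)) →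
        X1 A W J ∧ (H0 A W J ↔ H0 A W I)) := by
  induction m with
  | zero =>
    intro E _ _ _
    exact ⟨I, inferInstance, inferInstance, inferInstance, fun i => i.elim0,
      fun W _ _ _ => ⟨hI W, Iff.rfl⟩⟩
  | succ m ih =>
    intro E h1 h2 h3
    obtain ⟨J, _, _, hJ, hJ1, hJ2⟩ := ih (fun i => E i.castSucc) (fun i => h1 _) (fun i => h2 _)
      (fun i j hij => h3 _ _ (by simpa using hij))
    have := h1 (Fin.last m)
    obtain ⟨J', _, _, hJ', a, b, c, d⟩ := constr_left K hA J (E (Fin.last m)) (h2 _)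
    refine ⟨J', inferInstance, inferInstance, hJ', fun i => ?_, fun W _ _ hW => ?_⟩
    · refine Fin.lastCases ⟨a, b⟩ (fun i => ?_) i
      have h4 := h3 i.castSucc (Fin.last m) (Fin.castSucc_lt_last i)
      exact d _ h4.1 h4.2 (hJ1 i).1 (hJ1 i).2
    · have h5 := hJ2 W fun i => hW _
      have h6 := c W (hW (Fin.last m)).1 (hW (Fin.last m)).2
      exact ⟨h6.1 h5.1, h6.2.trans h5.2⟩

end Constr

section Euler

theorem proj_sub (hA : Hereditary A) {P : Type u} [AddCommGroup P] [Module A P]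
    [Module.Projective A P] (S : Submodule A P) : Module.Projective A S :=
  (IsProjective.iff_projective S).2
    (hA (ModuleCat.of A P) ((IsProjective.iff_projective P).1 inferInstance) S)

theorem exc_bij {X : ModuleCat.{u} A} (h : ExceptionalMod X) (e : X →ₗ[A] X) (he : e ≠ 0) :
    Function.Bijective e := by
  have := h.2.2.2 (ModuleCat.ofHom e) (fun h0 => he (congrArg ModuleCat.Hom.hom h0))
  exact (ConcreteCategory.isIso_iff_bijective (ModuleCat.ofHom e)).1 this

/-- f.g. modules -/
abbrev FG (A : Type u) [Ring A] := {N : ModuleCat.{u} A // Module.Finite A N}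

/-- the function `dim Hom(P,-)` -/
noncomputable def hv (K : Type u) [Field K] [Algebra K A] (P : ModuleCat.{u} A) : FG A → ℚ :=
  fun N => (hd K A P N.1 : ℚ)

/-- generators -/
def gens (K A : Type u) [Ring A] [Field K] [Algebra K A] : Set (FG A → ℚ) :=
  {v | ∃ P : ModuleCat.{u} A, ExceptionalMod P ∧ Module.Projective A P ∧ v = hv K P}

theorem hv_mem (K : Type u) [Field K] [Algebra K A] [FiniteDimensional K A] (hA : Hereditary A)
    (n : ℕ) : ∀ (P : ModuleCat.{u} A), Module.Finite A P → Module.Projective A P →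
      dm K A P ≤ n → hv K P ∈ Submodule.span ℚ (gens K A) := by
  have := noeth (A := A) K
  induction n with
  | zero =>
    intro P h1 h2 h3
    have h4 : ¬ Nontrivial P := fun h => by
      have := dm_pos (A := A) (M := P) K
      omega
    rw [not_nontrivial_iff_subsingleton] at h4
    have : hv K P = 0 := by
      funext N
      have : H0 A P N.1 := fun f => by ext x; rw [Subsingleton.elim x 0]; simp
      simp [hv, hd_zero K this]
    rw [this]; exact zero_mem _
  | succ n ih =>
    intro P h1 h2 h3
    by_cases h4 : Nontrivial P
    swap
    · rw [not_nontrivial_iff_subsingleton] at h4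
      have : hv K P = 0 := by
        funext N
        have : H0 A P N.1 := fun f => by ext x; rw [Subsingleton.elim x 0]; simp
        simp [hv, hd_zero K this]
      rw [this]; exact zero_mem _
    by_cases h5 : ∀ f : P ⟶ P, f ≠ 0 → IsIso f
    · exact Submodule.subset_span ⟨P, ⟨h1, (extZero_iff P P).2 X1.of_proj, h4, h5⟩, h2, rfl⟩
    push Not at h5
    obtain ⟨f, hf0, hf⟩ := h5
    have hs := SES.range f.hom
    have hd1 := dm_ses K hs
    have hpr := proj_sub hA (LinearMap.range f.hom)
    have hpk := proj_sub hA (LinearMap.ker f.hom)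
    have n1 : Nontrivial (LinearMap.range f.hom) := by
      rw [Submodule.nontrivial_iff_ne_bot]
      intro h
      exact hf0 (by ext1; exact LinearMap.range_eq_bot.1 h)
    have n2 : Nontrivial (LinearMap.ker f.hom) := by
      rw [Submodule.nontrivial_iff_ne_bot]
      intro h
      have hi := LinearMap.ker_eq_bot.1 h
      exact hf ((ConcreteCategory.isIso_iff_bijective f).2 ⟨hi, surj_of_dm K hi le_rfl⟩)
    have p1 := dm_pos (A := A) (M := LinearMap.range f.hom) K
    have p2 := dm_pos (A := A) (M := LinearMap.ker f.hom) K
    have e : hv K P = hv K (ModuleCat.of A (LinearMap.range f.hom)) +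
        hv K (ModuleCat.of A (LinearMap.ker f.hom)) := by
      funext N
      have := N.2
      have := hd_ses K hs (N := N.1) X1.of_proj
      simp [hv, this]
    rw [e]
    exact add_mem (ih _ (inferInstanceAs (Module.Finite A (LinearMap.range f.hom))) hpr (by
        change dm K A (LinearMap.range f.hom) ≤ n; omega))
      (ih _ (inferInstanceAs (Module.Finite A (LinearMap.ker f.hom))) hpk (by
        change dm K A (LinearMap.ker f.hom) ≤ n; omega))

theorem no_gens (K : Type u) [Field K] [Algebra K A] [FiniteDimensional K A] (hA : Hereditary A)
    (N : ℕ) (hmax : ∀ (n : ℕ) (F : Fin n → ModuleCat.{u} A), IsExcSeq F → n ≤ N)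
    (v : Fin (N + 1) → FG A → ℚ) (hv : ∀ i, v i ∈ gens K A) (hinj : Function.Injective v) :
    False := by
  choose P hP1 hP2 hP3 using hv
  have hfin := fun i => (hP1 i).1
  let d : Fin (N + 1) → ℕ := fun i => dm K A (P i)
  let σ := Tuple.sort d
  have hmono := Tuple.monotone_sort d
  have : IsExcSeq (fun i => P (σ i)) := by
    refine ⟨fun i => hP1 _, fun i j hij => ⟨(homZero_iff _ _).2 ?_, (extZero_iff _ _).2 X1.of_proj⟩⟩
    intro f
    by_contra hf
    have hpr := proj_sub hA (LinearMap.range f)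
    obtain ⟨s, hs⟩ := (SES.range f).section X1.of_proj
    have hsi : Function.Injective s := fun a b hab => by
      have := congrArg f.rangeRestrict hab
      rwa [← LinearMap.comp_apply, ← LinearMap.comp_apply, hs] at this
    have hb := exc_bij (hP1 (σ j)) (s ∘ₗ f.rangeRestrict) (fun h => hf (by
      ext x
      have h1 := LinearMap.congr_fun h x
      have h2 : f.rangeRestrict x = 0 := hsi (by simpa using h1)
      exact congrArg Subtype.val h2))
    have hfi : Function.Injective f := fun a b hab => hb.1 (by
      have : f.rangeRestrict a = f.rangeRestrict b := Subtype.ext hab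
      simp [this])
    have hfs := surj_of_dm K hfi (hmono hij.le)
    have : v (σ j) = v (σ i) := by
      rw [hP3, hP3]
      funext M
      simp only [ExcSeq.hv]
      rw [hd_congr K (LinearEquiv.ofBijective f ⟨hfi, hfs⟩)]
    exact hij.ne' (σ.injective (hinj this))
  have := hmax _ _ this
  omega

theorem no_indep (K : Type u) [Field K] [Algebra K A] [FiniteDimensional K A] (hA : Hereditary A)
    (N : ℕ) (hmax : ∀ (n : ℕ) (F : Fin n → ModuleCat.{u} A), IsExcSeq F → n ≤ N)
    (v : Fin (N + 1) → FG A → ℚ) (hv : ∀ i, v i ∈ Submodule.span ℚ (gens K A)) :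
    ¬ LinearIndependent ℚ v := by
  intro hv2
  obtain ⟨b, hb1, hb2, hb3⟩ := exists_linearIndependent ℚ (gens K A)
  rw [← hb2] at hv
  let v' : Fin (N + 1) → Submodule.span ℚ b := fun i => ⟨v i, hv i⟩
  have hv' : LinearIndependent ℚ v' :=
    LinearIndependent.of_comp (Submodule.span ℚ b).subtype hv2
  have h1 := hv'.cardinal_lift_le_rank
  rw [rank_span_set hb3] at h1
  simp only [Cardinal.mk_fin, Cardinal.lift_natCast] at h1
  have h2 : Cardinal.lift.{u+1} (Cardinal.mk (Fin (N+1))) ≤ Cardinal.lift.{0} (Cardinal.mk b) := by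
    simpa using h1
  obtain ⟨e⟩ := Cardinal.lift_mk_le'.1 h2
  exact no_gens K hA N hmax (fun i => (e i).1) (fun i => hb1 (e i).2)
    (fun i j hij => e.injective (Subtype.ext hij))

theorem exists_phi (K : Type u) [Field K] [Algebra K A] [FiniteDimensional K A]
    (hA : Hereditary A) (M : Type u) [AddCommGroup M] [Module A M] [Module.Finite A M] :
    ∃ φ : FG A → ℚ, φ ∈ Submodule.span ℚ (gens K A) ∧
      (∀ N : FG A, X1 A M N.1 → φ N = hd K A M N.1) ∧ (∀ N : FG A, 0 < φ N → ¬ H0 A M N.1) := by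
  have := noeth (A := A) K
  obtain ⟨r, g, hg⟩ := Module.Finite.exists_fin' A M
  have hP := SES.ker hg
  have hk := proj_sub hA (LinearMap.ker g)
  let e : (Fin r → A) ≃ₗ[A] (Fin r → A) := LinearEquiv.refl A _
  refine ⟨hv K (ModuleCat.of A (Fin r → A)) - hv K (ModuleCat.of A (LinearMap.ker g)),
    sub_mem (hv_mem K hA _ _ (inferInstanceAs (Module.Finite A (Fin r → A)))
      (inferInstanceAs (Module.Projective A (Fin r → A))) le_rfl)
     (hv_mem K hA _ _ (inferInstanceAs (Module.Finite A (LinearMap.ker g))) hk le_rfl),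
    fun N hN => ?_, fun N hN h0 => ?_⟩
  · have := N.2
    have := hd_ses K hP hN
    simp [hv, this]
  · have := N.2
    have := hd_le K hP h0
    simp only [hv, Pi.sub_apply, sub_pos, Nat.cast_lt] at hN
    exact absurd this (not_le.2 hN)

theorem key (K : Type u) [Field K] [Algebra K A] [FiniteDimensional K A]
    (hA : Hereditary A) {m : ℕ} (F : Fin (m + 2) → ModuleCat.{u} A) (hF : CompleteES F)
    (Z : Type u) [AddCommGroup Z] [Module A Z] [Module.Finite A Z] [Nontrivial Z]
    (hZ : X1 A Z Z)
    (hE : ∀ i : Fin m, H0 A Z (F i.castSucc.castSucc) ∧ X1 A Z (F i.castSucc.castSucc))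
    (hT : H0 A (F (Fin.last _)) Z) (hT1 : X1 A (F (Fin.last _)) Z) :
    (X1 A Z (F (Fin.last m).castSucc) → ¬ H0 A Z (F (Fin.last m).castSucc) →
      ¬ H0 A (F (Fin.last m).castSucc) Z) ∧
    (X1 A (F (Fin.last m).castSucc) Z → ¬ H0 A (F (Fin.last m).castSucc) Z →
      ¬ H0 A Z (F (Fin.last m).castSucc)) := by
  have hfin : ∀ i, Module.Finite A (F i) := fun i => (hF.1.1 i).1
  have hex : ∀ i, X1 A (F i) (F i) := fun i => (extZero_iff _ _).1 (hF.1.1 i).2.1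
  have hnt : ∀ i, Nontrivial (F i) := fun i => (hF.1.1 i).2.2.1
  have hid : ∀ (M : Type u) [AddCommGroup M] [Module A M] [Nontrivial M], ¬ H0 A M M := by
    intro M _ _ _ h
    obtain ⟨x, hx⟩ := exists_ne (0 : M)
    exact hx (by simpa using LinearMap.congr_fun (h LinearMap.id) x)
  have hph := fun i => exists_phi K hA (F i)
  choose φ h1 h2 h3 using hph
  obtain ⟨z, z1, z2, z3⟩ := exists_phi K hA Z
  let pF : Fin (m + 2) → FG A := fun i => ⟨F i, hfin i⟩
  let pZ : FG A := ⟨ModuleCat.of A Z, inferInstanceAs (Module.Finite A Z)⟩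
  have hφ0 : ∀ i j, i < j → φ j (pF i) = 0 := fun i j hij => by
    have := hF.1.2 i j hij
    rw [h2 j (pF i) ((extZero_iff _ _).1 this.2), hd_zero K ((homZero_iff _ _).1 this.1)]; simp
  have hφ1 : ∀ i, 0 < φ i (pF i) := fun i => by
    rw [h2 i (pF i) (hex i)]
    exact_mod_cast hd_pos K (hid _)
  have hz1 : 0 < z pZ := by
    rw [z2 pZ hZ]
    exact_mod_cast hd_pos K (hid Z)
  have hz0 : ∀ i : Fin m, z (pF i.castSucc.castSucc) = 0 := fun i => by
    rw [z2 (pF i.castSucc.castSucc) (hE i).2, hd_zero K (hE i).1]; simp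
  have ht0 : φ (Fin.last _) pZ = 0 := by
    rw [h2 _ pZ hT1, hd_zero K hT]; simp
  have hni := no_indep K hA (m + 2) hF.2 (Fin.cons z φ) (fun i => by
    refine Fin.cases z1 (fun i => ?_) i
    exact h1 i)
  rw [Fintype.not_linearIndependent_iff] at hni
  obtain ⟨g, hg, i0, hi0⟩ := hni
  rw [Fin.sum_univ_succ] at hg
  simp only [Fin.cons_zero, Fin.cons_succ] at hg
  have hc : ∀ n (hn : n < m), g (Fin.succ (Fin.castSucc (Fin.castSucc ⟨n, hn⟩))) = 0 := by
    intro n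
    induction n using Nat.strong_induction_on with
    | _ n ih =>
      intro hn
      have := congrFun hg (pF (Fin.castSucc (Fin.castSucc ⟨n, hn⟩)))
      simp only [Pi.add_apply, Pi.smul_apply, Finset.sum_apply, smul_eq_mul, hz0, mul_zero,
        zero_add, Pi.zero_apply] at this
      rw [Finset.sum_eq_single (Fin.castSucc (Fin.castSucc ⟨n, hn⟩))] at this
      · exact (mul_eq_zero.1 this).resolve_right (hφ1 _).ne'
      · intro j _ hj
        rcases lt_or_gt_of_ne hj with h | h
        · have hj' : (j : ℕ) < n := h
          have := ih j hj' (by omega)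
          rw [show j.succ = Fin.succ (Fin.castSucc (Fin.castSucc ⟨j, by omega⟩)) from rfl, this,
            zero_mul]
        · rw [hφ0 _ _ h, mul_zero]
      · simp
  rw [Fin.sum_univ_castSucc, Fin.sum_univ_castSucc] at hg
  rw [Finset.sum_eq_zero (fun (i : Fin m) _ => by rw [hc i.1 i.2, zero_smul]), zero_add] at hg
  generalize hc' : g 0 = c at *
  generalize ha' : g (Fin.succ (Fin.castSucc (Fin.last m))) = a at *
  generalize hb' : g (Fin.succ (Fin.last (m+1))) = b at *
  have eX := congrFun hg (pF (Fin.last m).castSucc)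
  have eT := congrFun hg (pF (Fin.last _))
  have eZ := congrFun hg pZ
  have hlt : (Fin.last m).castSucc < Fin.last (m + 1) := Fin.castSucc_lt_last _
  simp only [Pi.add_apply, Pi.smul_apply, smul_eq_mul, Pi.zero_apply] at eX eT eZ
  rw [hφ0 _ _ hlt] at eX
  rw [ht0] at eZ
  have pX := hφ1 (Fin.last m).castSucc
  have pT := hφ1 (Fin.last _)
  have hcne : c ≠ 0 := by
    intro h0
    have ha0 : a = 0 := by
      rw [h0] at eX
      simpa [pX.ne'] using eX
    have hb0 : b = 0 := by
      rw [h0, ha0] at eT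
      simpa [pT.ne'] using eT
    apply hi0
    refine Fin.cases ?_ (fun i => ?_) i0
    · rw [hc', h0]
    · refine Fin.lastCases ?_ (fun i => ?_) i
      · rw [hb', hb0]
      · refine Fin.lastCases ?_ (fun i => ?_) i
        · rw [ha', ha0]
        · exact hc i.1 i.2
  constructor
  · intro q1 q2
    have q3 : 0 < z (pF (Fin.last m).castSucc) := by
      rw [z2 _ q1]
      exact_mod_cast hd_pos K q2
    refine h3 _ pZ ?_
    have e1 : a * φ (Fin.last m).castSucc (pF (Fin.last m).castSucc) =
      - (c * z (pF (Fin.last m).castSucc)) := by linarith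
    have e2 : a * φ (Fin.last m).castSucc pZ = - (c * z pZ) := by linarith
    have hac : a * c < 0 := by
      have : (a * c) * φ (Fin.last m).castSucc (pF (Fin.last m).castSucc) < 0 := by
        have : (a * c) * φ (Fin.last m).castSucc (pF (Fin.last m).castSucc) =
          -(c ^ 2 * z (pF (Fin.last m).castSucc)) := by linear_combination c * e1
        rw [this]
        have : 0 < c ^ 2 := by positivity
        have := mul_pos this q3
        linarith
      by_contra hcon
      push Not at hcon
      have := mul_nonneg hcon pX.le
      linarith
    by_contra hcon
    push Not at hcon
    have h7 : (a * c) * φ (Fin.last m).castSucc pZ = -(c ^ 2 * z pZ) := by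
      linear_combination c * e2
    have h8 : 0 < c ^ 2 := by positivity
    have h9 := mul_pos h8 hz1
    have := mul_nonneg_of_nonpos_of_nonpos hac.le hcon
    linarith
  · intro q1 q2
    have q3 : 0 < φ (Fin.last m).castSucc pZ := by
      rw [h2 _ pZ q1]
      exact_mod_cast hd_pos K q2
    refine z3 (pF (Fin.last m).castSucc) ?_
    have e1 : a * φ (Fin.last m).castSucc (pF (Fin.last m).castSucc) =
      - (c * z (pF (Fin.last m).castSucc)) := by linarith
    have e2 : a * φ (Fin.last m).castSucc pZ = - (c * z pZ) := by linarith
    have hane : a ≠ 0 := by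
      rintro rfl
      have : c * z pZ = 0 := by linarith
      exact (mul_ne_zero hcne hz1.ne') this
    have h8 : 0 < a ^ 2 := by positivity
    have hac : a * c < 0 := by
      have : (a * c) * z pZ = -(a ^ 2 * φ (Fin.last m).castSucc pZ) := by
        linear_combination a * e2
      have := mul_pos h8 q3
      by_contra hcon
      push Not at hcon
      have := mul_nonneg hcon hz1.le
      linarith
    by_contra hcon
    push Not at hcon
    have h7 : (a * c) * z (pF (Fin.last m).castSucc) =
        -(a ^ 2 * φ (Fin.last m).castSucc (pF (Fin.last m).castSucc)) := by
      linear_combination a * e1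
    have h9 := mul_pos h8 pX
    have := mul_nonneg_of_nonpos_of_nonpos hac.le hcon
    linarith

end Euler

section Coind

/-- coinduced module -/
def Coind (K A X : Type u) [Ring A] [Field K] [Algebra K A] [AddCommGroup X] [Module K X] :
    Type u := A →ₗ[K] X

instance (K A X : Type u) [Ring A] [Field K] [Algebra K A] [AddCommGroup X] [Module K X] :
    AddCommGroup (Coind K A X) := inferInstanceAs (AddCommGroup (A →ₗ[K] X))

instance (K A X : Type u) [Ring A] [Field K] [Algebra K A] [AddCommGroup X] [Module K X] :
    Module K (Coind K A X) := inferInstanceAs (Module K (A →ₗ[K] X))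

theorem Coind.ext' {K A X : Type u} [Ring A] [Field K] [Algebra K A] [AddCommGroup X]
    [Module K X] {φ ψ : Coind K A X}
    (h : ∀ a : A, (show A →ₗ[K] X from φ) a = (show A →ₗ[K] X from ψ) a) : φ = ψ :=
  LinearMap.ext (f := (show A →ₗ[K] X from φ)) (g := (show A →ₗ[K] X from ψ)) h

instance (K A X : Type u) [Ring A] [Field K] [Algebra K A] [AddCommGroup X] [Module K X] :
    Module A (Coind K A X) where
  smul a φ := (show A →ₗ[K] X from φ) ∘ₗ LinearMap.mulRight K a
  one_smul φ := Coind.ext' fun b => congrArg (show A →ₗ[K] X from φ) (mul_one b)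
  mul_smul a a' φ := Coind.ext' fun b =>
    congrArg (show A →ₗ[K] X from φ) (mul_assoc b a a').symm
  smul_zero _ := Coind.ext' fun _ => rfl
  smul_add _ _ _ := Coind.ext' fun _ => rfl
  add_smul a a' φ := Coind.ext' fun b =>
    (congrArg (show A →ₗ[K] X from φ) (mul_add b a a')).trans (map_add _ _ _)
  zero_smul φ := Coind.ext' fun b =>
    (congrArg (show A →ₗ[K] X from φ) (mul_zero b)).trans (map_zero _)

theorem Coind.smul_app {K A X : Type u} [Ring A] [Field K] [Algebra K A] [AddCommGroup X]
    [Module K X] (a : A) (φ : Coind K A X) (b : A) :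
    (show A →ₗ[K] X from (a • φ)) b = (show A →ₗ[K] X from φ) (b * a) := rfl

instance (K A X : Type u) [Ring A] [Field K] [Algebra K A] [AddCommGroup X] [Module K X] :
    IsScalarTower K A (Coind K A X) where
  smul_assoc c a φ := Coind.ext' fun b => by
    have h : (show A →ₗ[K] X from (c • (a • φ))) b = c • (show A →ₗ[K] X from φ) (b * a) := rfl
    rw [h, Coind.smul_app, mul_smul_comm, map_smul]

theorem exists_inj (K : Type u) [Field K] [Algebra K A] [FiniteDimensional K A]
    (X : Type u) [AddCommGroup X] [Module A X] [Module.Finite A X] :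
    ∃ (I : Type u) (_ : AddCommGroup I) (_ : Module A I) (j : X →ₗ[A] I), Module.Finite A I ∧
      Function.Injective j ∧ ∀ (W : Type u) [AddCommGroup W] [Module A W], X1 A W I := by
  let := Module.restrictScalars K A X
  have := IsScalarTower.restrictScalars K A X
  have : Module.Finite K X := Module.Finite.trans A X
  have hfin : Module.Finite K (Coind K A X) := inferInstanceAs (Module.Finite K (A →ₗ[K] X))
  let toC : ∀ (N : Type u) [AddCommGroup N] [Module A N] [Module K N] [IsScalarTower K A N]
      (l : N →ₗ[K] X), N →ₗ[A] Coind K A X := fun N _ _ _ _ l =>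
    { toFun := fun n => (show Coind K A X from
        l ∘ₗ (LinearMap.toSpanSingleton A N n).restrictScalars K)
      map_add' := fun n n' => Coind.ext' fun b => by
        change l (b • (n + n')) = l (b • n) + l (b • n')
        rw [smul_add, map_add]
      map_smul' := fun a n => Coind.ext' fun b => by
        change l (b • (a • n)) = l ((b * a) • n)
        rw [mul_smul] }
  have hext : ∀ (M N : Type u) [AddCommGroup M] [Module A M] [AddCommGroup N] [Module A N]
      (i : M →ₗ[A] N) (_ : Function.Injective i) (k : M →ₗ[A] Coind K A X),
      ∃ l : N →ₗ[A] Coind K A X, l ∘ₗ i = k := by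
    intro M N _ _ _ _ i hi k
    let := Module.restrictScalars K A M
    have := IsScalarTower.restrictScalars K A M
    let := Module.restrictScalars K A N
    have := IsScalarTower.restrictScalars K A N
    let f : M →ₗ[K] N := i.restrictScalars K
    let k' : M →ₗ[K] X :=
      { toFun := fun n => (show A →ₗ[K] X from k n) 1
        map_add' := fun a b => by rw [map_add]; rfl
        map_smul' := fun c a => by
          rw [LinearMap.map_smul_of_tower]; rfl }
    obtain ⟨r, hr⟩ := LinearMap.exists_leftInverse_of_injective f (LinearMap.ker_eq_bot.2 hi)
    refine ⟨toC _ (k' ∘ₗ r), LinearMap.ext fun x => Coind.ext' fun b => ?_⟩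
    change k' (r (b • i x)) = _
    have h1 : r (b • i x) = b • x := by
      rw [← map_smul]; exact LinearMap.congr_fun hr (b • x)
    rw [h1]
    change (show A →ₗ[K] X from k (b • x)) 1 = _
    rw [map_smul, Coind.smul_app, one_mul]
  have hX1 : ∀ (W : Type u) [AddCommGroup W] [Module A W], X1 A W (Coind K A X) := by
    intro W _ _
    have hP := SES.ker (Finsupp.linearCombination_id_surjective A W)
    exact hP.con_right' X1.of_proj fun k => 
      hext (LinearMap.ker (Finsupp.linearCombination A (id : W → W))) (W →₀ A) (Submodule.subtype _)
        hP.inj k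
  refine ⟨Coind K A X, inferInstance, inferInstance, toC X LinearMap.id,
    Module.Finite.of_restrictScalars_finite K A _, fun x y hxy => ?_, fun W _ _ => hX1 W⟩
  · have : (show A →ₗ[K] X from toC X LinearMap.id x) 1 =
      (show A →ₗ[K] X from toC X LinearMap.id y) 1 := by rw [hxy]
    change (1 : A) • x = (1 : A) • y at this
    simpa using this

theorem exists_I (K : Type u) [Field K] [Algebra K A] [FiniteDimensional K A]
    (hA : Hereditary A)
    (X Y : Type u) [AddCommGroup X] [Module A X] [Module.Finite A X]
    [AddCommGroup Y] [Module A Y] [Module.Projective A Y] (hYX : ¬ H0 A Y X) :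
    ∃ (I : Type u) (_ : AddCommGroup I) (_ : Module A I), Module.Finite A I ∧
      (∀ (W : Type u) [AddCommGroup W] [Module A W], X1 A W I) ∧
      (∀ (W : Type u) [AddCommGroup W] [Module A W], H0 A Y W → H0 A W I) ∧
      ¬ H0 A X I := by
  have := noeth (A := A) K
  obtain ⟨I, _, _, j, hI, hj, hX⟩ := exists_inj (A := A) K X
  obtain ⟨N, hN, hmax⟩ := set_has_maximal_iff_noetherian.2 (inferInstanceAs (IsNoetherian A I))
    {N : Submodule A I | H0 A Y N} ⟨⊥, fun f => LinearMap.ext fun x => Subsingleton.elim _ _⟩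
  have hs := SES.sub N
  refine ⟨I ⧸ N, inferInstance, inferInstance, inferInstance, fun W _ _ => hs.cov_right hA (hX W),
    fun W _ _ hW f => ?_, fun h => hYX ?_⟩
  · let N' := (LinearMap.range f).comap N.mkQ
    have hle : N ≤ N' := fun x hx => by
      refine ⟨0, ?_⟩
      rw [map_zero]
      exact ((Submodule.Quotient.mk_eq_zero N).2 hx).symm
    have hN' : H0 A Y N' := by
      intro h
      obtain ⟨l, hl⟩ := Module.projective_lifting_property f.rangeRestrict
        ((N.mkQ ∘ₗ N'.subtype ∘ₗ h).codRestrict (LinearMap.range f) (fun y => (h y).2))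
        f.surjective_rangeRestrict
      have h0 : N.mkQ ∘ₗ N'.subtype ∘ₗ h = 0 := by
        ext y
        have := LinearMap.congr_fun hl y
        rw [hW l] at this
        exact (congrArg Subtype.val this).symm.trans (by simp)
      obtain ⟨e, he⟩ := hs.factor_ker _ h0
      rw [hN e] at he
      ext y
      simpa using (LinearMap.congr_fun he y).symm
    have hNN : N' = N := by
      by_contra hne
      exact hmax N' hN' (lt_of_le_of_ne hle (Ne.symm hne))
    ext w
    obtain ⟨x, hx⟩ := N.mkQ_surjective (f w)
    have hxN : x ∈ N' := ⟨w, hx.symm⟩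
    rw [hNN] at hxN
    rw [← hx]
    simpa using hxN
  · obtain ⟨e, he⟩ := hs.factor_ker j (h _)
    refine H0.of_inj (g := e) (fun a b hab => hj ?_) hN
    rw [← he]; simp [hab]

end Coind

section Core

theorem nontriv_of {M N : Type u} [AddCommGroup M] [Module A M] [AddCommGroup N] [Module A N]
    (h : ¬ H0 A M N) : Nontrivial M := by
  by_contra h1
  rw [not_nontrivial_iff_subsingleton] at h1
  exact h fun f => by ext x; rw [Subsingleton.elim x 0]; simp

theorem nontriv_of' {M N : Type u} [AddCommGroup M] [Module A M] [AddCommGroup N] [Module A N]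
    (h : ¬ H0 A M N) : Nontrivial N := by
  by_contra h1
  rw [not_nontrivial_iff_subsingleton] at h1
  exact h fun f => by ext x; exact Subsingleton.elim _ _

theorem core_proj (K : Type u) [Field K] [Algebra K A] [FiniteDimensional K A]
    (hA : Hereditary A) {m : ℕ} (F : Fin (m + 2) → ModuleCat.{u} A) (hF : CompleteES F)
    (Y : Type u) [AddCommGroup Y] [Module A Y] [Module.Finite A Y] [Module.Projective A Y]
    (hYE : ∀ i : Fin m, H0 A Y (F i.castSucc.castSucc))
    (hYX : ¬ H0 A Y (F (Fin.last m).castSucc))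
    (W : Type u) [AddCommGroup W] [Module A W] (hW0 : H0 A (F (Fin.last _)) W)
    (hW1 : X1 A (F (Fin.last _)) W) : X1 A (F (Fin.last m).castSucc) W := by
  have hfin : ∀ i, Module.Finite A (F i) := fun i => (hF.1.1 i).1
  have hex : ∀ i, X1 A (F i) (F i) := fun i => (extZero_iff _ _).1 (hF.1.1 i).2.1
  have hp0 : ∀ i j, i < j → H0 A (F j) (F i) := fun i j hij =>
    (homZero_iff _ _).1 (hF.1.2 i j hij).1
  have hp1 : ∀ i j, i < j → X1 A (F j) (F i) := fun i j hij =>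
    (extZero_iff _ _).1 (hF.1.2 i j hij).2
  have hlt : (Fin.last m).castSucc < Fin.last (m + 1) := Fin.castSucc_lt_last _
  have hlt2 : ∀ i : Fin m, i.castSucc.castSucc < Fin.last (m + 1) :=
    fun i => Fin.castSucc_lt_last _
  obtain ⟨X', _, _, hX', a1, a2, a3⟩ := constr_right K hA (F (Fin.last _)) Y (hex _)
  have b := a3 (F (Fin.last m).castSucc) (hp0 _ _ hlt) (hp1 _ _ hlt)
  have b2 : ¬ H0 A X' (F (Fin.last m).castSucc) := fun h => hYX (b.2.1 h)
  have := nontriv_of b2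
  have hk := (key K hA F hF X' (a3 X' a1 a2).1 (fun i => by
    have := a3 (F i.castSucc.castSucc) (hp0 _ _ (hlt2 i)) (hp1 _ _ (hlt2 i))
    exact ⟨this.2.2 (hYE i), this.1⟩) a1 a2).1 b.1 b2
  unfold H0 at hk
  push Not at hk
  obtain ⟨g, hg⟩ := hk
  have hs := SES.range g
  have hs2 := SES.sub (LinearMap.range g)
  have hTr : H0 A (F (Fin.last _)) (LinearMap.range g) := H0.of_inj hs2.inj a1
  have hTk : H0 A (F (Fin.last _)) (LinearMap.ker g) := H0.of_inj hs.inj (hp0 _ _ hlt)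
  have hTk1 : X1 A (F (Fin.last _)) (LinearMap.ker g) := hs.cov_left hTr (hp1 _ _ hlt)
  obtain ⟨s, hss⟩ := hs.section (hs2.con_left hA (a3 _ hTk hTk1).1)
  have hsi : Function.Injective s := fun a b hab => by
    have := congrArg g.rangeRestrict hab
    rwa [← LinearMap.comp_apply, ← LinearMap.comp_apply, hss] at this
  have hb := exc_bij (hF.1.1 _) (s ∘ₗ g.rangeRestrict) (fun h => hg (by
    ext x
    have h1 := LinearMap.congr_fun h x
    have h2 : g.rangeRestrict x = 0 := hsi (by simpa using h1)
    exact congrArg Subtype.val h2))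
  have hgi : Function.Injective g := fun a b hab => hb.1 (by
    have : g.rangeRestrict a = g.rangeRestrict b := Subtype.ext hab
    simp [this])
  have hs3 : SES g (LinearMap.range g).mkQ :=
    ⟨hgi, LinearMap.exact_map_mkQ_range g, Submodule.mkQ_surjective _⟩
  exact hs3.con_left hA (a3 W hW0 hW1).1

theorem core_inj (K : Type u) [Field K] [Algebra K A] [FiniteDimensional K A]
    (hA : Hereditary A) {m : ℕ} (F : Fin (m + 2) → ModuleCat.{u} A) (hF : CompleteES F)
    (Y : Type u) [AddCommGroup Y] [Module A Y] [Module.Projective A Y]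
    (hYT : H0 A Y (F (Fin.last _)))
    (hYX : ¬ H0 A Y (F (Fin.last m).castSucc))
    (W : Type u) [AddCommGroup W] [Module A W]
    (hW : ∀ i : Fin m, H0 A W (F i.castSucc.castSucc) ∧ X1 A W (F i.castSucc.castSucc)) :
    X1 A W (F (Fin.last m).castSucc) := by
  have hfin : ∀ i, Module.Finite A (F i) := fun i => (hF.1.1 i).1
  have hex : ∀ i, X1 A (F i) (F i) := fun i => (extZero_iff _ _).1 (hF.1.1 i).2.1
  have hp : ∀ i j, i < j → H0 A (F j) (F i) ∧ X1 A (F j) (F i) := fun i j hij =>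
    ⟨(homZero_iff _ _).1 (hF.1.2 i j hij).1, (extZero_iff _ _).1 (hF.1.2 i j hij).2⟩
  have hlt2 : ∀ i : Fin m, i.castSucc.castSucc < Fin.last (m + 1) :=
    fun i => Fin.castSucc_lt_last _
  have hlt3 : ∀ i : Fin m, i.castSucc.castSucc < (Fin.last m).castSucc :=
    fun i => Fin.castSucc_lt_castSucc_iff.2 (Fin.castSucc_lt_last _)
  obtain ⟨I, _, _, hI, i1, i2, i3⟩ := exists_I K hA (F (Fin.last m).castSucc) Y hYX
  obtain ⟨J, _, _, hJ, j1, j2⟩ := constr_left_seq K hA I i1 m (fun i => F i.castSucc.castSucc)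
    (fun i => hfin _) (fun i => hex _) (fun i j hij => hp _ _
      (Fin.castSucc_lt_castSucc_iff.2 (Fin.castSucc_lt_castSucc_iff.2 hij)))
  have b := j2 (F (Fin.last m).castSucc) (fun i => hp _ _ (hlt3 i))
  have b2 : ¬ H0 A (F (Fin.last m).castSucc) J := fun h => i3 (b.2.1 h)
  have t := j2 (F (Fin.last _)) (fun i => hp _ _ (hlt2 i))
  have := nontriv_of' b2
  have hk := (key K hA F hF J (j2 J j1).1 j1 (t.2.2 (i2 _ hYT)) t.1).2 b.1 b2
  unfold H0 at hk
  push Not at hk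
  obtain ⟨g, hg⟩ := hk
  have hs := SES.range g
  have hs2 := SES.sub (LinearMap.range g)
  have hq : ∀ i : Fin m, H0 A (F (Fin.last m).castSucc ⧸ LinearMap.range g)
      (F i.castSucc.castSucc) ∧ X1 A (F (Fin.last m).castSucc ⧸ LinearMap.range g)
      (F i.castSucc.castSucc) := fun i =>
    ⟨H0.of_surj hs2.surj (hp _ _ (hlt3 i)).1,
      hs2.con_right (H0.of_surj hs.surj (j1 i).1) (hp _ _ (hlt3 i)).2⟩
  obtain ⟨s, hss⟩ := hs2.section (hs.cov_right hA (j2 _ hq).1)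
  obtain ⟨r, hr⟩ := hs2.retract s hss
  have hr' : ∀ x, r (g x) = g.rangeRestrict x := fun x =>
    LinearMap.congr_fun hr (g.rangeRestrict x)
  have hb := exc_bij (hF.1.1 _) ((LinearMap.range g).subtype ∘ₗ r) (fun h => hg (by
    ext x
    have h1 := LinearMap.congr_fun h (g x)
    rw [LinearMap.comp_apply, hr'] at h1
    exact h1))
  have hgs : Function.Surjective g := fun x => by
    obtain ⟨y, hy⟩ := hb.2 x
    obtain ⟨z, hz⟩ := (r y).2
    exact ⟨z, hz.trans hy⟩
  exact (SES.ker hgs).cov_right hA (j2 W hW).1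

end Core

theorem main_aux (K : Type u) [Field K] [Algebra K A] [FiniteDimensional K A]
    (hA : Hereditary A) {m : ℕ} (F : Fin (m + 2) → ModuleCat.{u} A) (hF : CompleteES F)
    (Y : ModuleCat.{u} A) (hY : Projective Y) (hYe : ExceptionalMod Y)
    (hYE : ∀ i : Fin m, homZero Y (F i.castSucc.castSucc))
    (hYT : homZero Y (F (Fin.last _))) :
    RelProj F (Fin.last m).castSucc ∧ RelInj F (Fin.last m).castSucc ∧
      ProjIn (fun W => rperp (F (Fin.last _)) W) (F (Fin.last m).castSucc) := by
  have hYf := hYe.1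
  have hYp : Module.Projective A Y := (IsProjective.iff_projective (R := A) Y).2 hY
  have hlt : (Fin.last m).castSucc < Fin.last (m + 1) := Fin.castSucc_lt_last _
  have hYX : ¬ H0 A Y (F (Fin.last m).castSucc) := by
    intro h
    have hseq : IsExcSeq (Fin.snoc F Y : Fin (m + 3) → ModuleCat.{u} A) := by
      refine ⟨fun i => ?_, fun i j => ?_⟩
      · refine Fin.lastCases ?_ (fun i => ?_) i
        · rw [Fin.snoc_last]; exact hYe
        · rw [Fin.snoc_castSucc]; exact hF.1.1 i
      · refine Fin.lastCases (fun hi => ?_) (fun j => ?_) j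
        · revert hi
          refine Fin.lastCases (fun hi => absurd hi (lt_irrefl _)) (fun i _ => ?_) i
          rw [Fin.snoc_last, Fin.snoc_castSucc]
          refine ⟨?_, (extZero_iff _ _).2 X1.of_proj⟩
          refine Fin.lastCases hYT (fun i => ?_) i
          refine Fin.lastCases ((homZero_iff _ _).2 h) (fun i => hYE i) i
        · refine Fin.lastCases (fun hi => absurd hi (not_lt.2 (Fin.le_last _)))
            (fun i hi => ?_) i
          rw [Fin.snoc_castSucc, Fin.snoc_castSucc]
          exact hF.1.2 i j (Fin.castSucc_lt_castSucc_iff.1 hi)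
    have := hF.2 _ _ hseq
    omega
  have hP : ProjIn (fun W => rperp (F (Fin.last _)) W) (F (Fin.last m).castSucc) := by
    refine ⟨hF.1.2 _ _ hlt, fun U V hU hV p hp f => ?_⟩
    have hs : SES (LinearMap.ker p.hom).subtype p.hom :=
      SES.ker ((ModuleCat.epi_iff_surjective p).1 hp)
    have k0 : H0 A (F (Fin.last _)) (LinearMap.ker p.hom) :=
      H0.of_inj hs.inj ((homZero_iff _ _).1 hU.1)
    have k1 : X1 A (F (Fin.last _)) (LinearMap.ker p.hom) :=
      hs.cov_left ((homZero_iff _ _).1 hV.1) ((extZero_iff _ _).1 hU.2)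
    obtain ⟨l, hl⟩ := hs.lift (core_proj K hA F hF Y (fun i => (homZero_iff _ _).1 (hYE i)) hYX
      _ k0 k1) f.hom
    exact ⟨ModuleCat.ofHom l, by ext1; exact hl⟩
  refine ⟨⟨fun j hj => hF.1.2 _ _ hj, fun U V hU hV p hp f => ?_⟩, ⟨fun j hj => hF.1.2 _ _ hj,
    fun U V hU hV p hp f => ?_⟩, hP⟩
  · exact hP.2 U V (hU _ hlt) (hV _ hlt) p hp f
  · have hs : SES p.hom (LinearMap.range p.hom).mkQ :=
      ⟨(ModuleCat.mono_iff_injective p).1 hp, LinearMap.exact_map_mkQ_range _,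
        Submodule.mkQ_surjective _⟩
    have hlt3 : ∀ i : Fin m, i.castSucc.castSucc < (Fin.last m).castSucc :=
      fun i => Fin.castSucc_lt_castSucc_iff.2 (Fin.castSucc_lt_last _)
    obtain ⟨l, hl⟩ := hs.extend (core_inj K hA F hF Y ((homZero_iff _ _).1 hYT) hYX _
      (fun i => ⟨H0.of_surj hs.surj ((homZero_iff _ _).1 (hV _ (hlt3 i)).1),
        hs.con_right ((homZero_iff _ _).1 (hU _ (hlt3 i)).1)
          ((extZero_iff _ _).1 (hV _ (hlt3 i)).2)⟩)) f.hom
    exact ⟨ModuleCat.ofHom l, by ext1; exact hl⟩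

/-- Let `(E₁, …, E_{n-2}, X, T)` be a complete exceptional sequence and
`(E₁, …, E_{n-2}, T, Y)` the complete exceptional sequence obtained by braid mutation of
the last two terms. If `Y` is a projective module, then `X` is both relatively projective
and relatively injective in the first sequence; equivalently, `X` is a projective object
of `T^⊥`. -/
theorem stmt15 {K : Type u} [Field K] {A : Type u} [Ring A] [Algebra K A]
    [FiniteDimensional K A] (hA : Hereditary A)
    {m : ℕ} (E₀ : Fin m → ModuleCat.{u} A) (X T Y : ModuleCat.{u} A)
    (hF : CompleteES (Fin.snoc (Fin.snoc E₀ X) T))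
    (hG : CompleteES (Fin.snoc (Fin.snoc E₀ T) Y))
    (hY : Projective Y) :
    RelProj (Fin.snoc (Fin.snoc E₀ X) T) ⟨m, by omega⟩ ∧
    RelInj (Fin.snoc (Fin.snoc E₀ X) T) ⟨m, by omega⟩ ∧
    ProjIn (fun W => rperp T W) X := by
  have eE : ∀ (Z W : ModuleCat.{u} A) (i : Fin m),
      (Fin.snoc (Fin.snoc E₀ Z : Fin (m + 1) → ModuleCat.{u} A) W :
        Fin (m + 2) → ModuleCat.{u} A) i.castSucc.castSucc = E₀ i := fun Z W i => by
    rw [Fin.snoc_castSucc, Fin.snoc_castSucc]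
  have eX : ∀ (Z W : ModuleCat.{u} A),
      (Fin.snoc (Fin.snoc E₀ Z : Fin (m + 1) → ModuleCat.{u} A) W :
        Fin (m + 2) → ModuleCat.{u} A) (Fin.last m).castSucc = Z := fun Z W => by
    rw [Fin.snoc_castSucc, Fin.snoc_last]
  have eT : ∀ (Z W : ModuleCat.{u} A),
      (Fin.snoc (Fin.snoc E₀ Z : Fin (m + 1) → ModuleCat.{u} A) W :
        Fin (m + 2) → ModuleCat.{u} A) (Fin.last (m + 1)) = W := fun Z W => by
    rw [Fin.snoc_last]
  have hYe := hG.1.1 (Fin.last (m + 1))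
  rw [eT] at hYe
  have h := main_aux K hA _ hF Y hY hYe (fun i => by
    have := (hG.1.2 i.castSucc.castSucc (Fin.last (m + 1)) (Fin.castSucc_lt_last _)).1
    rw [eT, eE] at this
    rw [eE]; exact this) (by
    have := (hG.1.2 (Fin.last m).castSucc (Fin.last (m + 1)) (Fin.castSucc_lt_last _)).1
    rw [eT, eX] at this
    rw [eT]; exact this)
  refine ⟨h.1, h.2.1, ?_⟩
  have h3 := h.2.2
  rw [eT, eX] at h3
  exact h3

end ExcSeq
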